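/- Let E be a real Hilbert space, K ≥ 2, M ≥ 1, R ≥ 1, λ ∈ (1/K, 1], L > 0, 0 < η ≤ 1/L. Let f_1, …, f_K : E → ℝ be differentiable with L-Lipschitz gradients and bounded below, with f*_k = inf f_k. Let F(v_1,…,v_K) = Σ_{k=1}^K f_k((1/λ)·v_k − ((1−λ)/(λ(K−1)))·Σ_{k'≠k} v_{k'}). Consider SoftPull iterates on a probability space: random vectors w^{r,m}_k with w^{0,0}_k = w₀ deterministic and identical for all k, local steps w^{r,m+1}_k = w^{r,m}_k − η·g^{r,m}_k (0 ≤ m ≤ M−1), and mixing w^{r+1,0}_k = λ·w^{r,M}_k + ((1−λ)/(K−1))·Σ_{k'≠k} w^{r,M}_{k'}, where for all r, m, k: E⟨∇f_k(w^{r,m}_k), g^{r,m}_k⟩ = E‖∇f_k(w^{r,m}_k)‖², E‖g^{r,m}_k − ∇f_k(w^{r,m}_k)‖² ≤ σ², and E‖g^{r,m}_k‖² ≤ 2(G² + σ²). Then, writing w̄^{r,m} = (1/K)·Σ_{k=1}^K w^{r,m}_k and ∇_{v_k}F(w^{r,m}) for the gradient of F in its k-th component at (w^{r,m}_1,…,w^{r,m}_K):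 (1/(KRM))·Σ_{r=0}^{R−1} Σ_{m=0}^{M−1} Σ_{k=1}^K E‖∇_{v_k}F(w^{r,m})‖² ≤ 4·(1/λ² + (1−λ)²/(λ²(K−1)))·[ (4/(KηRM))·Σ_{k=1}^K (f_k(w₀) − f*_k) + 2ηLσ² + 2η²L²(G² + σ²)/M + (1/(KRM))·(8/η² + 2L/η)·((1−λ)²K²/(K−1)²)·Σ_{k=1}^K Σ_{r=0}^{R−1} E‖w^{r,M}_k − w̄^{r,M}‖² + (1/(KRM))·(2L²(1−λ)²K²/(λ²(K−1)²))·Σ_{k=1}^K Σ_{r=0}^{R−1} Σ_{m=0}^{M−1} E‖w^{r,m}_k − w̄^{r,m}‖² ]. -/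

import Mathlib

open MeasureTheory
open scoped RealInnerProductSpace


theorem sp_descent {E : Type*} [NormedAddCommGroup E] [InnerProductSpace ℝ E] [CompleteSpace E]
    (L : ℝ) (f : E → ℝ) (f' : E → E) (hgrad : ∀ x, HasGradientAt f (f' x) x)
    (hlip : ∀ x y, ‖f' x - f' y‖ ≤ L * ‖x - y‖) (x d : E) :
    f (x + d) ≤ f x + ⟪f' x, d⟫ + L / 2 * ‖d‖ ^ 2 := by
  have hd : ∀ t : ℝ, HasDerivAt (fun t : ℝ => f (x + t • d) - t * ⟪f' x, d⟫ - L / 2 * t ^ 2 * ‖d‖ ^ 2)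
      (⟪f' (x + t • d), d⟫ - ⟪f' x, d⟫ - L * t * ‖d‖ ^ 2) t := by
    intro t
    have h1 : HasDerivAt (fun t : ℝ => x + t • d) d t := by
      simpa using ((hasDerivAt_id t).smul_const d).const_add x
    have h2 := (hgrad (x + t • d)).hasFDerivAt.comp_hasDerivAt t h1
    have h3 : HasDerivAt (fun t : ℝ => t * ⟪f' x, d⟫) ⟪f' x, d⟫ t := by
      simpa using (hasDerivAt_id t).mul_const ⟪f' x, d⟫
    have h4 : HasDerivAt (fun t : ℝ => L / 2 * t ^ 2 * ‖d‖ ^ 2) (L * t * ‖d‖ ^ 2) t := by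
      have := (((hasDerivAt_id t).pow 2).const_mul (L / 2)).mul_const (‖d‖ ^ 2)
      refine this.congr_deriv ?_
      rw [Nat.cast_ofNat, id, show (2 - 1 : ℕ) = 1 from rfl, pow_one]; ring
    have h5 := (h2.sub h3).sub h4
    refine HasDerivAt.congr_deriv (f := fun t : ℝ => f (x + t • d) - t * ⟪f' x, d⟫ - L / 2 * t ^ 2 * ‖d‖ ^ 2) h5 ?_
    simp
  have hanti : AntitoneOn
      (fun t : ℝ => f (x + t • d) - t * ⟪f' x, d⟫ - L / 2 * t ^ 2 * ‖d‖ ^ 2) (Set.Icc 0 1) := by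
    apply antitoneOn_of_deriv_nonpos (convex_Icc 0 1)
    · exact fun t _ => (hd t).continuousAt.continuousWithinAt
    · exact fun t _ => (hd t).differentiableAt.differentiableWithinAt
    · intro t ht
      rw [interior_Icc] at ht
      rw [(hd t).deriv, ← inner_sub_left]
      have h1 := real_inner_le_norm (f' (x + t • d) - f' x) d
      have h2 := hlip (x + t • d) x
      have h3 : ‖x + t • d - x‖ = t * ‖d‖ := by
        rw [add_sub_cancel_left, norm_smul, Real.norm_of_nonneg ht.1.le]
      rw [h3] at h2
      have := mul_le_mul_of_nonneg_right h2 (norm_nonneg d)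
      nlinarith
  have := hanti (Set.left_mem_Icc.2 zero_le_one) (Set.right_mem_Icc.2 zero_le_one) zero_le_one
  simp at this
  linarith

theorem sp_norm_add_sq {E : Type*} [NormedAddCommGroup E] [InnerProductSpace ℝ E] (a b : E) :
    ‖a + b‖ ^ 2 ≤ 2 * ‖a‖ ^ 2 + 2 * ‖b‖ ^ 2 := by
  have := parallelogram_law_with_norm ℝ a b
  nlinarith [sq_nonneg ‖a - b‖]

theorem sp_mat {E : Type*} [NormedAddCommGroup E] [InnerProductSpace ℝ E]
    (K : ℕ) (c p : ℝ) (hc : 0 ≤ c) (hp : p = 1 + c * ((K : ℝ) - 1)) (a : Fin K → E) :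
    ∑ k, ‖p • a k - c • ∑ j ∈ Finset.univ.erase k, a j‖ ^ 2 ≤ (p + c) ^ 2 * ∑ k, ‖a k‖ ^ 2 := by
  set S := ∑ j, a j with hS
  have h1 : ∀ k, ‖p • a k - c • ∑ j ∈ Finset.univ.erase k, a j‖ ^ 2
      = (p + c) ^ 2 * ‖a k‖ ^ 2 - 2 * (p + c) * c * ⟪a k, S⟫ + c ^ 2 * ‖S‖ ^ 2 := by
    intro k
    have : p • a k - c • ∑ j ∈ Finset.univ.erase k, a j = (p + c) • a k - c • S := by
      rw [hS, ← Finset.add_sum_erase _ _ (Finset.mem_univ k)]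
      module
    rw [this, norm_sub_sq_real, norm_smul, norm_smul, inner_smul_left, inner_smul_right,
      mul_pow, mul_pow, Real.norm_eq_abs, Real.norm_eq_abs, sq_abs, sq_abs]
    simp; ring
  simp_rw [h1]
  rw [Finset.sum_add_distrib, Finset.sum_sub_distrib, ← Finset.mul_sum, ← Finset.mul_sum,
    ← sum_inner, ← hS, real_inner_self_eq_norm_sq]
  simp only [Finset.sum_const, Finset.card_univ, Fintype.card_fin, nsmul_eq_mul]
  have hk : (0:ℝ) ≤ K := K.cast_nonneg
  have : 0 ≤ c * ‖S‖ ^ 2 * (2 + c * K) := by positivity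
  subst hp
  nlinarith

theorem sp_grad {E : Type*} [NormedAddCommGroup E] [InnerProductSpace ℝ E] [CompleteSpace E]
    (K : ℕ) (p c : ℝ) (f : Fin K → E → ℝ) (f' : Fin K → E → E)
    (hgrad : ∀ k x, HasGradientAt (f k) (f' k x) x) (w : Fin K → E) (k : Fin K) (G : E)
    (hG : HasGradientAt
        (fun x : E => ∑ k', f k' (p • Function.update w k x k' -
            c • ∑ j ∈ Finset.univ.erase k', Function.update w k x j)) G (w k)) :
    G = p • f' k (p • w k - c • ∑ j ∈ Finset.univ.erase k, w j) -
      c • ∑ k' ∈ Finset.univ.erase k, f' k' (p • w k' - c • ∑ j ∈ Finset.univ.erase k', w j) := by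
  set u : Fin K → E := fun k' => p • w k' - c • ∑ j ∈ Finset.univ.erase k', w j with hu
  set b : Fin K → ℝ := fun k' => if k' = k then p else -c with hb
  have hup : ∀ x j, Function.update w k x j = w j + (if j = k then x - w k else 0) := by
    intro x j
    by_cases h : j = k
    · subst h; simp
    · simp [h]
  have haff : ∀ x k', p • Function.update w k x k' -
            c • ∑ j ∈ Finset.univ.erase k', Function.update w k x j = u k' + b k' • (x - w k) := by
    intro x k'
    simp_rw [hup, Finset.sum_add_distrib, Finset.sum_ite_eq']
    by_cases h : k' = k
    · subst h
      simp [hu, hb]; module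
    · have h' : k ≠ k' := fun e => h e.symm
      simp [hu, hb, h, h']; module
  simp_rw [haff] at hG
  have h2 : HasGradientAt (fun x : E => ∑ k', f k' (u k' + b k' • (x - w k)))
      (∑ k', b k' • f' k' (u k')) (w k) := by
    rw [hasGradientAt_iff_hasFDerivAt, map_sum]
    apply HasFDerivAt.fun_sum
    intro k' _
    have h3 : HasFDerivAt (fun x : E => u k' + b k' • (x - w k))
        (b k' • ContinuousLinearMap.id ℝ E) (w k) :=
      (((hasFDerivAt_id (w k)).sub_const (w k)).const_smul (b k')).const_add (u k')
    have h4 : HasFDerivAt (f k') (InnerProductSpace.toDual ℝ E (f' k' (u k')))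
        (u k' + b k' • (w k - w k)) := by
      simpa using (hgrad k' (u k')).hasFDerivAt
    have h5 := h4.comp (w k) h3
    refine HasFDerivAt.congr_fderiv (f := fun x : E => f k' (u k' + b k' • (x - w k))) h5 ?_
    apply ContinuousLinearMap.ext
    intro y
    simp
  rw [hG.unique h2, ← Finset.add_sum_erase _ _ (Finset.mem_univ k)]
  have : ∑ x ∈ Finset.univ.erase k, b x • f' x (u x) =
      ∑ x ∈ Finset.univ.erase k, (-c) • f' x (u x) := by
    apply Finset.sum_congr rfl
    intro x hx
    simp [hb, Finset.ne_of_mem_erase hx]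
  rw [this, ← Finset.smul_sum]
  have hbk : b k = p := by simp [hb]
  rw [hbk, neg_smul, ← sub_eq_add_neg]

/-- pointwise bound -/
theorem sp_point {E : Type*} [NormedAddCommGroup E] [InnerProductSpace ℝ E] [CompleteSpace E]
    (K : ℕ) (hK : 2 ≤ K) (lam L : ℝ) (hlam0 : 0 < lam) (hlam1 : lam ≤ 1)
    (f : Fin K → E → ℝ) (f' : Fin K → E → E)
    (hgrad : ∀ k x, HasGradientAt (f k) (f' k x) x)
    (hlip : ∀ k x y, ‖f' k x - f' k y‖ ≤ L * ‖x - y‖) (w Fg : Fin K → E)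
    (hFg : ∀ (k : Fin K), HasGradientAt
        (fun x : E => ∑ k', f k'
          ((1 / lam) • Function.update w k x k' -
            ((1 - lam) / (lam * ((K : ℝ) - 1))) •
              ∑ j ∈ Finset.univ.erase k', Function.update w k x j)) (Fg k) (w k)) :
    ∑ k, ‖Fg k‖ ^ 2 ≤ 4 * (1 / lam ^ 2 + (1 - lam) ^ 2 / (lam ^ 2 * ((K : ℝ) - 1))) *
      (∑ k, ‖f' k (w k)‖ ^ 2 +
        (2 * L ^ 2 * (1 - lam) ^ 2 * (K : ℝ) ^ 2 / (lam ^ 2 * ((K : ℝ) - 1) ^ 2)) *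
          ∑ k, ‖w k - (1 / (K : ℝ)) • ∑ k', w k'‖ ^ 2) := by
  have hK' : (2:ℝ) ≤ K := by exact_mod_cast hK
  have hK1 : (1:ℝ) ≤ (K:ℝ) - 1 := by linarith
  have hK0 : (0:ℝ) < (K:ℝ) - 1 := by linarith
  set c := (1 - lam) / (lam * ((K : ℝ) - 1)) with hc
  have hc0 : 0 ≤ c := div_nonneg (by linarith) (by positivity)
  have hp : 1 / lam = 1 + c * ((K:ℝ) - 1) := by rw [hc]; field_simp; ring
  set u : Fin K → E := fun k' => (1 / lam) • w k' - c • ∑ j ∈ Finset.univ.erase k', w j with hu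
  have h1 : ∑ k, ‖Fg k‖ ^ 2 ≤ (1 / lam + c) ^ 2 * ∑ k, ‖f' k (u k)‖ ^ 2 := by
    have := sp_mat K c (1 / lam) hc0 hp (fun k => f' k (u k))
    refine le_trans (le_of_eq ?_) this
    refine Finset.sum_congr rfl fun k _ => ?_
    rw [sp_grad K (1/lam) c f f' hgrad w k (Fg k) (hFg k)]
  have h2 : ∀ k, ‖f' k (u k)‖ ^ 2 ≤ 2 * ‖f' k (w k)‖ ^ 2 +
      2 * (L ^ 2 * (c * K) ^ 2 * ‖w k - (1 / (K : ℝ)) • ∑ k', w k'‖ ^ 2) := by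
    intro k
    have e : u k - w k = (c * K) • (w k - (1 / (K : ℝ)) • ∑ k', w k') := by
      have : (c * K) • (w k - (1 / (K : ℝ)) • ∑ k', w k') = (c * K) • w k - c • ∑ k', w k' := by
        rw [smul_sub, smul_smul]
        congr 2
        field_simp
      rw [this, hu, ← Finset.add_sum_erase _ _ (Finset.mem_univ k), hp]
      module
    have a1 := sp_norm_add_sq (f' k (w k)) (f' k (u k) - f' k (w k))
    rw [add_sub_cancel] at a1
    have a2 := pow_le_pow_left₀ (norm_nonneg _) (hlip k (u k) (w k)) 2
    rw [e, norm_smul, Real.norm_of_nonneg (by positivity)] at a2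
    nlinarith
  have h3 := Finset.sum_le_sum (s := Finset.univ) fun k _ => h2 k
  rw [Finset.sum_add_distrib, ← Finset.mul_sum, ← Finset.mul_sum, ← Finset.mul_sum] at h3
  have h4 : (1 / lam + c) ^ 2 ≤ 2 * (1 / lam ^ 2 + (1 - lam) ^ 2 / (lam ^ 2 * ((K : ℝ) - 1))) := by
    have : c ^ 2 ≤ (1 - lam) ^ 2 / (lam ^ 2 * ((K : ℝ) - 1)) := by
      rw [hc, div_pow, mul_pow]
      gcongr
      nlinarith
    have e : (1:ℝ) / lam ^ 2 = (1 / lam) ^ 2 := by rw [div_pow, one_pow]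
    rw [e]
    nlinarith [sq_nonneg (1 / lam - c)]
  set B := 1 / lam ^ 2 + (1 - lam) ^ 2 / (lam ^ 2 * ((K : ℝ) - 1))
  have hB : 0 ≤ B := by positivity
  set D := ∑ k, ‖w k - (1 / (K : ℝ)) • ∑ k', w k'‖ ^ 2
  have hD : 0 ≤ D := Finset.sum_nonneg fun _ _ => by positivity
  have e2 : 2 * L ^ 2 * (1 - lam) ^ 2 * (K : ℝ) ^ 2 / (lam ^ 2 * ((K : ℝ) - 1) ^ 2)
      = 2 * (L ^ 2 * (c * K) ^ 2) := by
    rw [hc]; field_simp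
  rw [e2]
  have hS : 0 ≤ ∑ k, ‖f' k (u k)‖ ^ 2 := Finset.sum_nonneg fun _ _ => by positivity
  have hX : 0 ≤ L ^ 2 * (c * K) ^ 2 * D := by positivity
  calc _ ≤ _ := h1
    _ ≤ 2 * B * ∑ k, ‖f' k (u k)‖ ^ 2 := by gcongr
    _ ≤ 2 * B * (2 * ∑ k, ‖f' k (w k)‖ ^ 2 + 2 * (L ^ 2 * (c * K) ^ 2 * D)) := by gcongr
    _ ≤ 2 * B * (2 * (∑ k, ‖f' k (w k)‖ ^ 2 + 2 * (L ^ 2 * (c * K) ^ 2) * D)) := by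
        gcongr; linarith
    _ = _ := by ring

theorem sp_client {E : Type*} [NormedAddCommGroup E] [InnerProductSpace ℝ E] [CompleteSpace E]
    {Ω : Type*} [MeasurableSpace Ω] (μ : Measure Ω) [IsProbabilityMeasure μ]
    (M R : ℕ) (hM : 1 ≤ M)
    (L η σ G β : ℝ) (hL : 0 < L) (hη0 : 0 < η) (hη1 : η ≤ 1 / L)
    (f : E → ℝ) (f' : E → E)
    (hgrad : ∀ x, HasGradientAt f (f' x) x)
    (hlip : ∀ x y, ‖f' x - f' y‖ ≤ L * ‖x - y‖)
    (hbdd : BddBelow (Set.range f))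
    (w₀ : E) (w g d : ℕ → ℕ → Ω → E)
    (hinit : ∀ ω, w 0 0 ω = w₀)
    (hlocal : ∀ r, ∀ m < M, ∀ ω, w r (m + 1) ω = w r m ω - η • g r m ω)
    (hmix : ∀ r ω, w (r + 1) 0 ω = w r M ω + (-β) • d r M ω)
    (hfI : ∀ r m, Integrable (fun ω => f (w r m ω)) μ)
    (hinnerI : ∀ r m, Integrable (fun ω => ⟪f' (w r m ω), g r m ω⟫) μ)
    (hgradI : ∀ r m, Integrable (fun ω => ‖f' (w r m ω)‖ ^ 2) μ)
    (hgI : ∀ r m, Integrable (fun ω => ‖g r m ω‖ ^ 2) μ)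
    (hdevI : ∀ r m, Integrable (fun ω => ‖d r m ω‖ ^ 2) μ)
    (hunbiased : ∀ r m,
      ∫ ω, ⟪f' (w r m ω), g r m ω⟫ ∂μ = ∫ ω, ‖f' (w r m ω)‖ ^ 2 ∂μ)
    (hvar : ∀ r m, ∫ ω, ‖g r m ω - f' (w r m ω)‖ ^ 2 ∂μ ≤ σ ^ 2)
    (hg2 : ∀ r m, ∫ ω, ‖g r m ω‖ ^ 2 ∂μ ≤ 2 * (G ^ 2 + σ ^ 2)) :
    ∑ r ∈ Finset.range R, ∑ m ∈ Finset.range M, ∫ ω, ‖f' (w r m ω)‖ ^ 2 ∂μ ≤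
      4 / η * (f w₀ - ⨅ x, f x) + R * (M * (2 * η * L * σ ^ 2) +
        2 * η ^ 2 * L ^ 2 * (G ^ 2 + σ ^ 2)) +
      (8 / η ^ 2 + 2 * L / η) * β ^ 2 * ∑ r ∈ Finset.range R, ∫ ω, ‖d r M ω‖ ^ 2 ∂μ := by
  have hLη : L * η ≤ 1 := by
    rw [le_div_iff₀ hL] at hη1; linarith
  have hloc : ∀ r, ∀ m < M, ∫ ω, f (w r (m+1) ω) ∂μ ≤ ∫ ω, f (w r m ω) ∂μ -
      η / 2 * ∫ ω, ‖f' (w r m ω)‖ ^ 2 ∂μ + L * η ^ 2 * σ ^ 2 / 2 := by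
    intro r m hm
    have h1 : ∀ ω, f (w r (m+1) ω) ≤ f (w r m ω) - η * ⟪f' (w r m ω), g r m ω⟫
        + L / 2 * η ^ 2 * ‖g r m ω‖ ^ 2 := by
      intro ω
      have := sp_descent L f f' hgrad hlip (w r m ω) (-(η • g r m ω))
      rw [← sub_eq_add_neg, ← hlocal r m hm ω, inner_neg_right, inner_smul_right, norm_neg,
        norm_smul, mul_pow, Real.norm_eq_abs, sq_abs] at this
      linarith
    have h2 := integral_mono (hfI r (m+1))
      (((hfI r m).sub' ((hinnerI r m).const_mul η)).add ((hgI r m).const_mul (L / 2 * η ^ 2))) h1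
    have e1 : ∫ ω, (f (w r m ω) - η * ⟪f' (w r m ω), g r m ω⟫
        + L / 2 * η ^ 2 * ‖g r m ω‖ ^ 2) ∂μ = ∫ ω, f (w r m ω) ∂μ -
        η * ∫ ω, ‖f' (w r m ω)‖ ^ 2 ∂μ + L / 2 * η ^ 2 * ∫ ω, ‖g r m ω‖ ^ 2 ∂μ := by
      rw [integral_add ((hfI r m).sub' ((hinnerI r m).const_mul η))
        ((hgI r m).const_mul (L / 2 * η ^ 2)), integral_sub (hfI r m) ((hinnerI r m).const_mul η),
        integral_const_mul, integral_const_mul, hunbiased]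
    have h2' := h2.trans_eq e1
    have e2 : ∫ ω, ‖g r m ω - f' (w r m ω)‖ ^ 2 ∂μ =
        ∫ ω, ‖g r m ω‖ ^ 2 ∂μ - ∫ ω, ‖f' (w r m ω)‖ ^ 2 ∂μ := by
      have : ∀ ω, ‖g r m ω - f' (w r m ω)‖ ^ 2 =
          ‖g r m ω‖ ^ 2 - 2 * ⟪f' (w r m ω), g r m ω⟫ + ‖f' (w r m ω)‖ ^ 2 := by
        intro ω
        rw [norm_sub_sq_real, real_inner_comm]
      simp_rw [this]
      rw [integral_add ((hgI r m).sub' ((hinnerI r m).const_mul 2)) (hgradI r m),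
        integral_sub (hgI r m) ((hinnerI r m).const_mul 2), integral_const_mul, hunbiased]
      ring
    have h3 := hvar r m
    rw [e2] at h3
    have h0 : 0 ≤ ∫ ω, ‖f' (w r m ω)‖ ^ 2 ∂μ := integral_nonneg fun ω => by positivity
    have h4 : L / 2 * η ^ 2 * ∫ ω, ‖g r m ω‖ ^ 2 ∂μ ≤
        L / 2 * η ^ 2 * (σ ^ 2 + ∫ ω, ‖f' (w r m ω)‖ ^ 2 ∂μ) := by
      apply mul_le_mul_of_nonneg_left _ (by positivity)
      linarith
    have h5 : L * η * (η / 2 * ∫ ω, ‖f' (w r m ω)‖ ^ 2 ∂μ) ≤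
        1 * (η / 2 * ∫ ω, ‖f' (w r m ω)‖ ^ 2 ∂μ) :=
      mul_le_mul_of_nonneg_right hLη (by positivity)
    linarith
  have htel : ∀ r, ∀ m ≤ M, ∫ ω, f (w r m ω) ∂μ ≤ ∫ ω, f (w r 0 ω) ∂μ -
      η / 2 * ∑ i ∈ Finset.range m, ∫ ω, ‖f' (w r i ω)‖ ^ 2 ∂μ + m * (L * η ^ 2 * σ ^ 2 / 2) := by
    intro r m
    induction m with
    | zero => intro _; simp
    | succ m ih =>
      intro hm
      have h1 := ih (by omega)
      have h2 := hloc r m (by omega)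
      rw [Finset.sum_range_succ]
      push_cast
      linarith
  have hmx : ∀ r, ∫ ω, f (w (r+1) 0 ω) ∂μ ≤ ∫ ω, f (w r M ω) ∂μ +
      η / 4 * ∫ ω, ‖f' (w r (M-1) ω)‖ ^ 2 ∂μ + η / 4 * L ^ 2 * η ^ 2 * (2 * (G ^ 2 + σ ^ 2)) +
      (2 / η + L / 2) * β ^ 2 * ∫ ω, ‖d r M ω‖ ^ 2 ∂μ := by
    intro r
    have h1 : ∀ ω, f (w (r+1) 0 ω) ≤ f (w r M ω) + η / 4 * ‖f' (w r (M-1) ω)‖ ^ 2 +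
        η / 4 * L ^ 2 * η ^ 2 * ‖g r (M-1) ω‖ ^ 2 + (2 / η + L / 2) * β ^ 2 * ‖d r M ω‖ ^ 2 := by
      intro ω
      have a1 := sp_descent L f f' hgrad hlip (w r M ω) ((-β) • d r M ω)
      rw [← hmix] at a1
      have a2 : ‖(-β) • d r M ω‖ ^ 2 = β ^ 2 * ‖d r M ω‖ ^ 2 := by
        rw [norm_smul, mul_pow, Real.norm_eq_abs, sq_abs, neg_sq]
      have a3 := real_inner_le_norm (f' (w r M ω)) ((-β) • d r M ω)
      have a4 : ‖f' (w r M ω)‖ * ‖(-β) • d r M ω‖ ≤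
          η / 8 * ‖f' (w r M ω)‖ ^ 2 + 2 / η * ‖(-β) • d r M ω‖ ^ 2 := by
        generalize ‖f' (w r M ω)‖ = x
        generalize ‖(-β) • d r M ω‖ = y
        have : 0 ≤ (η * x - 4 * y) ^ 2 / (8 * η) := by positivity
        have e : (η * x - 4 * y) ^ 2 / (8 * η) = η / 8 * x ^ 2 + 2 / η * y ^ 2 - x * y := by
          field_simp; ring
        linarith
      have a5 := sp_norm_add_sq (f' (w r (M-1) ω)) (f' (w r M ω) - f' (w r (M-1) ω))
      rw [add_sub_cancel] at a5
      have a6 := pow_le_pow_left₀ (norm_nonneg _) (hlip (w r M ω) (w r (M-1) ω)) 2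
      have a7 : w r M ω - w r (M-1) ω = -(η • g r (M-1) ω) := by
        have := hlocal r (M-1) (by omega) ω
        rw [Nat.sub_add_cancel hM] at this
        rw [this]; abel
      have a8 : ‖w r M ω - w r (M-1) ω‖ ^ 2 = η ^ 2 * ‖g r (M-1) ω‖ ^ 2 := by
        rw [a7, norm_neg, norm_smul, mul_pow, Real.norm_eq_abs, sq_abs]
      rw [mul_pow, a8] at a6
      rw [a2] at a4 a1
      have a9 : η / 8 * ‖f' (w r M ω)‖ ^ 2 ≤ η / 8 * (2 * ‖f' (w r (M-1) ω)‖ ^ 2 +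
          2 * (L ^ 2 * (η ^ 2 * ‖g r (M-1) ω‖ ^ 2))) := by
        apply mul_le_mul_of_nonneg_left _ (by positivity)
        linarith
      linarith
    have i1 := (hfI r M).fun_add ((hgradI r (M-1)).const_mul (η / 4))
    have i2 := i1.fun_add ((hgI r (M-1)).const_mul (η / 4 * L ^ 2 * η ^ 2))
    have i3 := i2.fun_add ((hdevI r M).const_mul ((2 / η + L / 2) * β ^ 2))
    have h2 := integral_mono (hfI (r+1) 0) i3 h1
    have e1 : ∫ ω, (f (w r M ω) + η / 4 * ‖f' (w r (M-1) ω)‖ ^ 2 +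
        η / 4 * L ^ 2 * η ^ 2 * ‖g r (M-1) ω‖ ^ 2 + (2 / η + L / 2) * β ^ 2 * ‖d r M ω‖ ^ 2) ∂μ =
        ∫ ω, f (w r M ω) ∂μ + η / 4 * ∫ ω, ‖f' (w r (M-1) ω)‖ ^ 2 ∂μ +
        η / 4 * L ^ 2 * η ^ 2 * ∫ ω, ‖g r (M-1) ω‖ ^ 2 ∂μ +
        (2 / η + L / 2) * β ^ 2 * ∫ ω, ‖d r M ω‖ ^ 2 ∂μ := by
      rw [← integral_const_mul, ← integral_const_mul, ← integral_const_mul,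
        ← integral_add (hfI r M) ((hgradI r (M-1)).const_mul (η / 4)),
        ← integral_add i1 ((hgI r (M-1)).const_mul (η / 4 * L ^ 2 * η ^ 2)),
        ← integral_add i2 ((hdevI r M).const_mul ((2 / η + L / 2) * β ^ 2))]
    have h3 := h2.trans_eq e1
    have h4 := mul_le_mul_of_nonneg_left (hg2 r (M-1))
      (show 0 ≤ η / 4 * L ^ 2 * η ^ 2 by positivity)
    linarith
  have hround : ∀ n, ∫ ω, f (w n 0 ω) ∂μ ≤ f w₀ -
      η / 4 * ∑ r ∈ Finset.range n, ∑ m ∈ Finset.range M, ∫ ω, ‖f' (w r m ω)‖ ^ 2 ∂μ +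
      n * (M * (L * η ^ 2 * σ ^ 2 / 2) + η / 4 * L ^ 2 * η ^ 2 * (2 * (G ^ 2 + σ ^ 2))) +
      (2 / η + L / 2) * β ^ 2 * ∑ r ∈ Finset.range n, ∫ ω, ‖d r M ω‖ ^ 2 ∂μ := by
    intro n
    induction n with
    | zero => simp [hinit]
    | succ n ih =>
      have h1 := htel n M le_rfl
      have h2 := hmx n
      have h3 : ∫ ω, ‖f' (w n (M-1) ω)‖ ^ 2 ∂μ ≤
          ∑ m ∈ Finset.range M, ∫ ω, ‖f' (w n m ω)‖ ^ 2 ∂μ :=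
        Finset.single_le_sum (f := fun m => ∫ ω, ‖f' (w n m ω)‖ ^ 2 ∂μ)
          (fun m _ => integral_nonneg fun ω => by positivity)
          (Finset.mem_range.2 (by omega))
      have h4 := mul_le_mul_of_nonneg_left h3 (show 0 ≤ η / 4 by positivity)
      rw [Finset.sum_range_succ, Finset.sum_range_succ]
      push_cast
      linarith
  have hlow : ⨅ x, f x ≤ ∫ ω, f (w R 0 ω) ∂μ := by
    have := integral_mono (μ := μ) (integrable_const (⨅ x, f x)) (hfI R 0)
      (fun ω => ciInf_le hbdd (w R 0 ω))
    simpa using this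
  have hfin := hlow.trans (hround R)
  set A := ∑ r ∈ Finset.range R, ∑ m ∈ Finset.range M, ∫ ω, ‖f' (w r m ω)‖ ^ 2 ∂μ
  set D := ∑ r ∈ Finset.range R, ∫ ω, ‖d r M ω‖ ^ 2 ∂μ
  have h6 : A = 4 / η * (η / 4 * A) := by field_simp
  rw [h6]
  have h7 : η / 4 * A ≤ f w₀ - (⨅ x, f x) +
      R * (M * (L * η ^ 2 * σ ^ 2 / 2) + η / 4 * L ^ 2 * η ^ 2 * (2 * (G ^ 2 + σ ^ 2))) +
      (2 / η + L / 2) * β ^ 2 * D := by linarith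
  refine (mul_le_mul_of_nonneg_left h7 (show 0 ≤ 4 / η by positivity)).trans (le_of_eq ?_)
  field_simp
  ring

/-- Non-asymptotic convergence of SoftPull (paper's Theorem 1): for `λ ∈ (1/K, 1]`,
`L`-smooth bounded-below losses, step size `0 < η ≤ 1/L`, identically initialized
SoftPull iterates with conditionally unbiased stochastic gradients of variance ≤ σ²
and second moment ≤ 2(G²+σ²), the averaged expected squared partial gradients of the
SoftPull objective `F` are bounded as stated. -/
theorem stmt_19 {E : Type*} [NormedAddCommGroup E] [InnerProductSpace ℝ E] [CompleteSpace E]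
    {Ω : Type*} [MeasurableSpace Ω] (μ : Measure Ω) [IsProbabilityMeasure μ]
    (K M R : ℕ) (hK : 2 ≤ K) (hM : 1 ≤ M) (hR : 1 ≤ R)
    (lam L η σ G : ℝ) (hlam0 : 1 / (K : ℝ) < lam) (hlam1 : lam ≤ 1)
    (hL : 0 < L) (hη0 : 0 < η) (hη1 : η ≤ 1 / L)
    (f : Fin K → E → ℝ) (f' : Fin K → E → E)
    (hgrad : ∀ k x, HasGradientAt (f k) (f' k x) x)
    (hlip : ∀ k x y, ‖f' k x - f' k y‖ ≤ L * ‖x - y‖)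
    (hbdd : ∀ k, BddBelow (Set.range (f k)))
    (w₀ : E) (w g : ℕ → ℕ → Fin K → Ω → E) (Fg : ℕ → ℕ → Fin K → Ω → E)
    (hinit : ∀ k ω, w 0 0 k ω = w₀)
    (hlocal : ∀ r, ∀ m < M, ∀ k ω, w r (m + 1) k ω = w r m k ω - η • g r m k ω)
    (hmix : ∀ r k ω, w (r + 1) 0 k ω =
      lam • w r M k ω +
        ((1 - lam) / ((K : ℝ) - 1)) • ∑ k' ∈ Finset.univ.erase k, w r M k' ω)
    (hFg : ∀ r m (k : Fin K) ω,
      HasGradientAt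
        (fun x : E => ∑ k', f k'
          ((1 / lam) • Function.update (fun j => w r m j ω) k x k' -
            ((1 - lam) / (lam * ((K : ℝ) - 1))) •
              ∑ j ∈ Finset.univ.erase k', Function.update (fun j => w r m j ω) k x j))
        (Fg r m k ω) (w r m k ω))
    (hfI : ∀ r m k, Integrable (fun ω => f k (w r m k ω)) μ)
    (hinnerI : ∀ r m k, Integrable (fun ω => ⟪f' k (w r m k ω), g r m k ω⟫) μ)
    (hgradI : ∀ r m k, Integrable (fun ω => ‖f' k (w r m k ω)‖ ^ 2) μ)
    (hvarI : ∀ r m k, Integrable (fun ω => ‖g r m k ω - f' k (w r m k ω)‖ ^ 2) μ)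
    (hgI : ∀ r m k, Integrable (fun ω => ‖g r m k ω‖ ^ 2) μ)
    (hdevI : ∀ r m k, Integrable
      (fun ω => ‖w r m k ω - (1 / (K : ℝ)) • ∑ k', w r m k' ω‖ ^ 2) μ)
    (hFgI : ∀ r m k, Integrable (fun ω => ‖Fg r m k ω‖ ^ 2) μ)
    (hunbiased : ∀ r m k,
      ∫ ω, ⟪f' k (w r m k ω), g r m k ω⟫ ∂μ = ∫ ω, ‖f' k (w r m k ω)‖ ^ 2 ∂μ)
    (hvar : ∀ r m k, ∫ ω, ‖g r m k ω - f' k (w r m k ω)‖ ^ 2 ∂μ ≤ σ ^ 2)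
    (hg2 : ∀ r m k, ∫ ω, ‖g r m k ω‖ ^ 2 ∂μ ≤ 2 * (G ^ 2 + σ ^ 2)) :
    (1 / ((K : ℝ) * R * M)) * ∑ r ∈ Finset.range R, ∑ m ∈ Finset.range M,
        ∑ k, ∫ ω, ‖Fg r m k ω‖ ^ 2 ∂μ ≤
      4 * (1 / lam ^ 2 + (1 - lam) ^ 2 / (lam ^ 2 * ((K : ℝ) - 1))) *
        ((4 / ((K : ℝ) * η * R * M)) * ∑ k, (f k w₀ - ⨅ x, f k x) +
          2 * η * L * σ ^ 2 + 2 * η ^ 2 * L ^ 2 * (G ^ 2 + σ ^ 2) / M +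
          (1 / ((K : ℝ) * R * M)) * (8 / η ^ 2 + 2 * L / η) *
            ((1 - lam) ^ 2 * (K : ℝ) ^ 2 / ((K : ℝ) - 1) ^ 2) *
            ∑ k, ∑ r ∈ Finset.range R,
              ∫ ω, ‖w r M k ω - (1 / (K : ℝ)) • ∑ k', w r M k' ω‖ ^ 2 ∂μ +
          (1 / ((K : ℝ) * R * M)) *
            (2 * L ^ 2 * (1 - lam) ^ 2 * (K : ℝ) ^ 2 / (lam ^ 2 * ((K : ℝ) - 1) ^ 2)) *
            ∑ k, ∑ r ∈ Finset.range R, ∑ m ∈ Finset.range M,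
              ∫ ω, ‖w r m k ω - (1 / (K : ℝ)) • ∑ k', w r m k' ω‖ ^ 2 ∂μ) := by
  have hK' : (2:ℝ) ≤ K := by exact_mod_cast hK
  have hKp : (0:ℝ) < K := by linarith
  have hK0 : (0:ℝ) < (K:ℝ) - 1 := by linarith
  have hRp : (0:ℝ) < R := by exact_mod_cast hR
  have hMp : (0:ℝ) < M := by exact_mod_cast hM
  have hlam : 0 < lam := lt_trans (by positivity) hlam0
  have hclient := fun k => sp_client μ M R hM L η σ G ((1 - lam) * K / ((K:ℝ) - 1)) hL hη0 hη1
    (f k) (f' k) (hgrad k) (hlip k) (hbdd k) w₀ (fun r m => w r m k) (fun r m => g r m k)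
    (fun r m ω => w r m k ω - (1 / (K : ℝ)) • ∑ k', w r m k' ω)
    (hinit k) (fun r m hm => hlocal r m hm k)
    (by
      intro r ω
      have e : (-((1 - lam) * K / ((K:ℝ) - 1))) •
          (w r M k ω - (1 / (K : ℝ)) • ∑ k', w r M k' ω) =
          (-((1 - lam) * K / ((K:ℝ) - 1))) • w r M k ω +
            ((1 - lam) / ((K:ℝ) - 1)) • ∑ k', w r M k' ω := by
        rw [smul_sub, smul_smul, sub_eq_add_neg, ← neg_smul]
        congr 2
        field_simp
      have e2 : -((1 - lam) * K / ((K:ℝ) - 1)) = lam - 1 - (1 - lam) / ((K:ℝ) - 1) := by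
        field_simp; ring
      change w (r + 1) 0 k ω = w r M k ω + _
      rw [hmix, e, e2, ← Finset.add_sum_erase _ _ (Finset.mem_univ k)]
      module)
    (fun r m => hfI r m k) (fun r m => hinnerI r m k) (fun r m => hgradI r m k)
    (fun r m => hgI r m k) (fun r m => hdevI r m k) (fun r m => hunbiased r m k)
    (fun r m => hvar r m k) (fun r m => hg2 r m k)
  have hsum := Finset.sum_le_sum (s := Finset.univ) fun k _ => hclient k
  rw [Finset.sum_add_distrib, Finset.sum_add_distrib, ← Finset.mul_sum, ← Finset.mul_sum,
    ← Finset.mul_sum] at hsum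
  simp only [Finset.sum_const, Finset.card_univ, Fintype.card_fin, nsmul_eq_mul] at hsum
  have hpt : ∀ r m, ∑ k, ∫ ω, ‖Fg r m k ω‖ ^ 2 ∂μ ≤
      4 * (1 / lam ^ 2 + (1 - lam) ^ 2 / (lam ^ 2 * ((K : ℝ) - 1))) *
      (∑ k, ∫ ω, ‖f' k (w r m k ω)‖ ^ 2 ∂μ +
        (2 * L ^ 2 * (1 - lam) ^ 2 * (K : ℝ) ^ 2 / (lam ^ 2 * ((K : ℝ) - 1) ^ 2)) *
          ∑ k, ∫ ω, ‖w r m k ω - (1 / (K : ℝ)) • ∑ k', w r m k' ω‖ ^ 2 ∂μ) := by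
    intro r m
    have i1 := integrable_finsetSum Finset.univ fun k _ => hgradI r m k
    have i2 := integrable_finsetSum Finset.univ fun k _ => hdevI r m k
    rw [← integral_finsetSum _ fun k _ => hFgI r m k, ← integral_finsetSum _ fun k _ => hgradI r m k,
      ← integral_finsetSum _ fun k _ => hdevI r m k, ← integral_const_mul,
      ← integral_add i1 (i2.const_mul _), ← integral_const_mul]
    refine integral_mono (integrable_finsetSum Finset.univ fun k _ => hFgI r m k)
      ((i1.fun_add (i2.const_mul _)).const_mul _) fun ω => ?_
    exact sp_point K hK lam L hlam hlam1 f f' hgrad hlip (fun k => w r m k ω)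
      (fun k => Fg r m k ω) (fun k => hFg r m k ω)
  have hall := Finset.sum_le_sum (s := Finset.range R) fun r _ =>
    Finset.sum_le_sum (s := Finset.range M) fun m _ => hpt r m
  simp_rw [← Finset.mul_sum, Finset.sum_add_distrib, ← Finset.mul_sum] at hall
  have swap : ∀ a : ℕ → ℕ → Fin K → ℝ,
      ∑ r ∈ Finset.range R, ∑ m ∈ Finset.range M, ∑ k, a r m k =
      ∑ k, ∑ r ∈ Finset.range R, ∑ m ∈ Finset.range M, a r m k := by
    intro a
    rw [Finset.sum_comm (s := Finset.univ)]
    exact Finset.sum_congr rfl fun r _ => Finset.sum_comm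
  rw [swap (fun r m k => ∫ ω, ‖f' k (w r m k ω)‖ ^ 2 ∂μ),
    swap (fun r m k => ∫ ω, ‖w r m k ω - (1 / (K : ℝ)) • ∑ k', w r m k' ω‖ ^ 2 ∂μ)] at hall
  have hB : 0 ≤ 4 * (1 / lam ^ 2 + (1 - lam) ^ 2 / (lam ^ 2 * ((K : ℝ) - 1))) := by positivity
  set B := 4 * (1 / lam ^ 2 + (1 - lam) ^ 2 / (lam ^ 2 * ((K : ℝ) - 1)))
  set C := 2 * L ^ 2 * (1 - lam) ^ 2 * (K : ℝ) ^ 2 / (lam ^ 2 * ((K : ℝ) - 1) ^ 2)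
  set DD := ∑ k, ∑ r ∈ Finset.range R, ∑ m ∈ Finset.range M,
              ∫ ω, ‖w r m k ω - (1 / (K : ℝ)) • ∑ k', w r m k' ω‖ ^ 2 ∂μ
  set D := ∑ k, ∑ r ∈ Finset.range R,
              ∫ ω, ‖w r M k ω - (1 / (K : ℝ)) • ∑ k', w r M k' ω‖ ^ 2 ∂μ
  set A := ∑ k, ∑ r ∈ Finset.range R, ∑ m ∈ Finset.range M, ∫ ω, ‖f' k (w r m k ω)‖ ^ 2 ∂μ
  set S := ∑ k, (f k w₀ - ⨅ x, f k x)
  have hfin := hall.trans (mul_le_mul_of_nonneg_left (add_le_add_left hsum (C * DD)) hB)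
  refine (mul_le_mul_of_nonneg_left hfin
    (show 0 ≤ 1 / ((K : ℝ) * R * M) by positivity)).trans (le_of_eq ?_)
  rw [mul_left_comm]
  congr 1
  generalize C = C
  field_simp
  ring
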